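/- Let p̄_σ be the Gaussian mixture density with means θ_1,…,θ_K, weights p_1,…,p_K and standard deviation σ. Then ∫_{−∞}^{∞} (p̄_σ′(θ))² / p̄_σ(θ) dθ = 1/σ² − ε, where ε = ∫_{−∞}^{∞} [ Σ_{k=1}^K Σ_{n=1}^K f_k(θ) f_n(θ) (θ_k − θ_n)² ] / ( 2 σ⁴ p̄_σ(θ) ) dθ. (This is the paper's evaluation of the prior Fisher information term [F_P]_{θθ}.) -/

import Mathlib

open MeasureTheory Filter Real Finset

open ProbabilityTheory NNReal in
lemma integrable_sq_mul_gaussianPDFReal (μ : ℝ) {v : ℝ≥0} (hv : v ≠ 0) :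
    Integrable fun t ↦ (t - μ) ^ 2 * gaussianPDFReal μ v t := by
  have h : Integrable (fun t ↦ (t - μ) ^ 2) (gaussianReal μ v) :=
    ((memLp_id_gaussianReal 2).sub (memLp_const μ)).integrable_sq
  rw [gaussianReal_of_var_ne_zero _ hv,
    integrable_withDensity_iff (measurable_gaussianPDF μ v)
      (ae_of_all _ fun _ ↦ gaussianPDF_lt_top)] at h
  simpa only [toReal_gaussianPDF] using h

open ProbabilityTheory NNReal in
lemma integral_sq_mul_gaussianPDFReal (μ : ℝ) {v : ℝ≥0} (hv : v ≠ 0) :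
    ∫ t, (t - μ) ^ 2 * gaussianPDFReal μ v t = v := by
  have h := variance_fun_id_gaussianReal (μ := μ) (v := v)
  rw [variance_eq_integral aemeasurable_id', integral_id_gaussianReal,
    integral_gaussianReal_eq_integral_smul hv] at h
  simpa only [smul_eq_mul, mul_comm] using h

/-- Lagrange-type identity: a weighted sum of squared differences in terms of weighted moments
about an arbitrary point. -/
lemma sum_sum_mul_mul_sub_sq {ι : Type*} (s : Finset ι) (w x : ι → ℝ) (t : ℝ) :
    ∑ k ∈ s, ∑ n ∈ s, w k * w n * (x k - x n) ^ 2 =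
      2 * ((∑ k ∈ s, w k) * ∑ k ∈ s, (t - x k) ^ 2 * w k) -
        2 * (∑ k ∈ s, (t - x k) * w k) ^ 2 := by
  have h : ∀ k n, w k * w n * (x k - x n) ^ 2 =
      ((t - x k) ^ 2 * w k) * w n + w k * ((t - x n) ^ 2 * w n) -
        2 * (((t - x k) * w k) * ((t - x n) * w n)) := fun k n ↦ by ring
  simp only [h, sum_sub_distrib, sum_add_distrib, ← mul_sum, ← sum_mul]
  ring

/-- Evaluation of the prior Fisher information of a Gaussian
mixture: `∫ (p̄_σ′)²/p̄_σ = 1/σ² − ε`, where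
`ε = ∫ [Σₖ Σₙ fₖ(θ) fₙ(θ) (θₖ − θₙ)²] / (2σ⁴ p̄_σ(θ)) dθ`. -/
theorem stmt3
    (K : ℕ) (hK : 1 ≤ K)
    (p : Fin K → ℝ) (hp : ∀ k, 0 < p k) (hpsum : ∑ k, p k = 1)
    (θ : Fin K → ℝ) (σ : ℝ) (hσ : 0 < σ)
    (f : Fin K → ℝ → ℝ)
    (hf : ∀ k t, f k t =
      p k / (Real.sqrt (2 * Real.pi) * σ) * Real.exp (-(t - θ k) ^ 2 / (2 * σ ^ 2)))
    (pbar : ℝ → ℝ)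
    (hpbar : ∀ t, pbar t = ∑ k, f k t) :
    (∫ t : ℝ, (deriv pbar t) ^ 2 / pbar t) =
      1 / σ ^ 2 -
        ∫ t : ℝ, (∑ k, ∑ n, f k t * f n t * (θ k - θ n) ^ 2) / (2 * σ ^ 4 * pbar t) := by
  have : NeZero K := ⟨by omega⟩
  obtain ⟨v, hvσ⟩ : ∃ v : NNReal, (v : ℝ) = σ ^ 2 := ⟨⟨σ ^ 2, sq_nonneg σ⟩, rfl⟩
  have hv : v ≠ 0 := NNReal.coe_ne_zero.mp (hvσ ▸ (pow_pos hσ 2).ne')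
  have hfpdf : ∀ k t, f k t =
      p k * ProbabilityTheory.gaussianPDFReal (θ k) v t := fun k t ↦ by
    rw [hf, ProbabilityTheory.gaussianPDFReal_def]
    beta_reduce
    rw [hvσ, Real.sqrt_mul (x := 2 * π) (by positivity), Real.sqrt_sq hσ.le]
    ring
  have hfpos : ∀ k t, 0 < f k t := fun k t ↦ by
    have := hp k
    rw [hf]
    positivity
  have hpos : ∀ t, 0 < pbar t := fun t ↦ by
    rw [hpbar]
    exact sum_pos (fun k _ ↦ hfpos k t) univ_nonempty
  have hderiv : ∀ t, deriv pbar t = -(∑ k, (t - θ k) * f k t) / σ ^ 2 := fun t ↦ by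
    have hk : ∀ k, HasDerivAt (f k) (-((t - θ k) * f k t) / σ ^ 2) t := fun k ↦ by
      rw [hf k t, funext (hf k)]
      have hexp := ((((hasDerivAt_id' t).sub_const (θ k)).fun_pow 2).fun_neg.div_const
        (2 * σ ^ 2)).exp.const_mul (p k / (√(2 * π) * σ))
      refine hexp.congr_deriv ?_
      push_cast
      field_simp
    rw [funext hpbar, (HasDerivAt.fun_sum fun k _ ↦ hk k).deriv, ← sum_div, sum_neg_distrib]
  have hterm : ∀ k, (fun t ↦ (t - θ k) ^ 2 * f k t) = fun t ↦ p k *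
      ((t - θ k) ^ 2 * ProbabilityTheory.gaussianPDFReal (θ k) v t) :=
    fun k ↦ funext fun t ↦ by rw [hfpdf]; ring
  have htermint : ∀ k, Integrable fun t ↦ (t - θ k) ^ 2 * f k t := fun k ↦ by
    rw [hterm]
    exact (integrable_sq_mul_gaussianPDFReal (θ k) hv).const_mul _
  have hmom : ∫ t, (∑ k, (t - θ k) ^ 2 * f k t) / σ ^ 4 = 1 / σ ^ 2 := by
    rw [integral_div, integral_finsetSum _ fun k _ ↦ htermint k]
    simp only [hterm, integral_const_mul, integral_sq_mul_gaussianPDFReal _ hv, hvσ]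
    rw [← sum_mul, hpsum]
    field_simp
  have hmomint : Integrable fun t ↦ (∑ k, (t - θ k) ^ 2 * f k t) / σ ^ 4 :=
    (integrable_finsetSum _ fun k _ ↦ htermint k).div_const _
  have hsplit : ∀ t, (deriv pbar t) ^ 2 / pbar t = (∑ k, (t - θ k) ^ 2 * f k t) / σ ^ 4 -
      (∑ k, ∑ n, f k t * f n t * (θ k - θ n) ^ 2) / (2 * σ ^ 4 * pbar t) := fun t ↦ by
    have := (hpos t).ne'
    rw [hderiv, sum_sum_mul_mul_sub_sq _ (fun k ↦ f k t) θ t, ← hpbar]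
    field_simp
    ring
  have hfcont : ∀ k, Continuous (f k) := fun k ↦ by
    rw [funext (hf k)]
    fun_prop
  have hpcont : Continuous pbar := by
    rw [funext hpbar]
    fun_prop
  have hepsint : Integrable fun t ↦
      (∑ k, ∑ n, f k t * f n t * (θ k - θ n) ^ 2) / (2 * σ ^ 4 * pbar t) := by
    refine hmomint.mono' (Continuous.aestronglyMeasurable ?_) (ae_of_all _ fun t ↦ ?_)
    · exact Continuous.div (by fun_prop) (by fun_prop) fun t ↦
        mul_ne_zero (by positivity) (hpos t).ne'
    · have hnonneg : 0 ≤ (∑ k, ∑ n, f k t * f n t * (θ k - θ n) ^ 2) / (2 * σ ^ 4 * pbar t) :=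
        div_nonneg (sum_nonneg fun k _ ↦ sum_nonneg fun n _ ↦
          mul_nonneg (mul_nonneg (hfpos k t).le (hfpos n t).le) (sq_nonneg _))
          (mul_nonneg (by positivity) (hpos t).le)
      rw [Real.norm_of_nonneg hnonneg]
      have := div_nonneg (sq_nonneg (deriv pbar t)) (hpos t).le
      linarith [hsplit t]
  simp only [hsplit]
  rw [integral_sub hmomint hepsint, hmom]
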